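/- The function φ(x) = (1/2)·log(1-x) + 2x·K(x)·(E(x) - K(x)) / (2E(x)² - 2E(x)K(x) + x(1-x)K(x)²) is strictly decreasing on (0,1), with limit 8/5 as x → 0⁺ and limit log 4 as x → 1⁻. -/

import Mathlib

open Real Set Filter

noncomputable def K (x : ℝ) : ℝ :=
  ∫ t in (0 : ℝ)..(π / 2), (1 - x * Real.sin t ^ 2) ^ (-(1/2) : ℝ)

noncomputable def E (x : ℝ) : ℝ :=
  ∫ t in (0 : ℝ)..(π / 2), (1 - x * Real.sin t ^ 2) ^ ((1/2) : ℝ)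

noncomputable def φ (x : ℝ) : ℝ :=
  (1/2) * Real.log (1 - x) +
    2 * x * K x * (E x - K x) / (2 * E x ^ 2 - 2 * E x * K x + x * (1 - x) * K x ^ 2)


lemma delta_pos {x : ℝ} (hx : x < 1) (t : ℝ) : 0 < 1 - x * Real.sin t ^ 2 := by
  have h1 := Real.sin_sq_add_cos_sq t
  have h2 := sq_nonneg (Real.sin t)
  have h3 := sq_nonneg (Real.cos t)
  nlinarith [mul_nonneg (sub_nonneg.2 hx.le) h2, mul_nonneg (sub_nonneg.2 hx.le) h3]

lemma cont_delta {x : ℝ} (hx : x < 1) (p : ℝ) :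
    Continuous fun t : ℝ => (1 - x * Real.sin t ^ 2) ^ p := by
  refine Continuous.rpow_const (by fun_prop) ?_
  intro t
  exact Or.inl (delta_pos hx t).ne'

lemma hasDerivAt_I (p x : ℝ) (hx : x < 1) :
    HasDerivAt (fun x : ℝ => ∫ t in (0 : ℝ)..(π / 2), (1 - x * Real.sin t ^ 2) ^ p)
      (∫ t in (0 : ℝ)..(π / 2), (-(Real.sin t ^ 2)) * p * (1 - x * Real.sin t ^ 2) ^ (p - 1)) x := by
  have hc : x < (x + 1) / 2 := by linarith
  have hc1 : (x + 1) / 2 < 1 := by linarith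
  have hcont : ContinuousOn (fun q : ℝ × ℝ =>
      (-(Real.sin q.2 ^ 2)) * p * (1 - q.1 * Real.sin q.2 ^ 2) ^ (p - 1))
      (Icc (x - 1) ((x + 1) / 2) ×ˢ Icc 0 (π / 2)) := by
    refine ContinuousOn.mul (by fun_prop) (ContinuousOn.rpow_const (by fun_prop) ?_)
    rintro ⟨a, b⟩ hab
    exact Or.inl (delta_pos (lt_of_le_of_lt hab.1.2 hc1) b).ne'
  obtain ⟨C, hC⟩ := (isCompact_Icc.prod isCompact_Icc).exists_bound_of_continuousOn hcont
  have hs : Ioo (x - 1) ((x + 1) / 2) ∈ nhds x := Ioo_mem_nhds (by linarith) hc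
  refine (intervalIntegral.hasDerivAt_integral_of_dominated_loc_of_deriv_le
    (bound := fun _ => C) (F := fun x t => (1 - x * Real.sin t ^ 2) ^ p)
    (F' := fun x t => (-(Real.sin t ^ 2)) * p * (1 - x * Real.sin t ^ 2) ^ (p - 1))
    hs ?_ ?_ ?_ ?_ ?_ ?_).2
  · filter_upwards [Iio_mem_nhds hx] with y hy
    exact (cont_delta hy p).aestronglyMeasurable
  · exact (cont_delta hx p).intervalIntegrable _ _
  · exact (Continuous.mul (by fun_prop) (cont_delta hx (p - 1))).aestronglyMeasurable
  · refine Filter.Eventually.of_forall ?_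
    intro t ht y hy
    rw [uIoc_of_le (by positivity)] at ht
    exact hC (y, t) ⟨⟨hy.1.le, hy.2.le⟩, ⟨ht.1.le, ht.2⟩⟩
  · exact intervalIntegrable_const
  · refine Filter.Eventually.of_forall ?_
    intro t ht y hy
    have h1 : HasDerivAt (fun y : ℝ => 1 - y * Real.sin t ^ 2) (-(Real.sin t ^ 2)) y := by
      simpa using ((hasDerivAt_id y).mul_const (Real.sin t ^ 2)).const_sub 1
    exact h1.rpow_const (Or.inl (delta_pos (hy.2.trans hc1) t).ne')

lemma rpow_mh {a : ℝ} (ha : 0 < a) : a ^ (-(1/2) : ℝ) = 1 / √a := by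
  rw [Real.rpow_neg ha.le, ← Real.sqrt_eq_rpow, one_div]

lemma rpow_m3h {a : ℝ} (ha : 0 < a) : a ^ (-(1/2) - 1 : ℝ) = 1 / (√a * a) := by
  rw [Real.rpow_sub ha, Real.rpow_one, rpow_mh ha]; field_simp

lemma K_eq {x : ℝ} (hx : x < 1) :
    K x = ∫ t in (0 : ℝ)..(π / 2), 1 / √(1 - x * Real.sin t ^ 2) := by
  unfold K
  exact intervalIntegral.integral_congr fun t _ => rpow_mh (delta_pos hx t)

lemma E_eq (x : ℝ) :
    E x = ∫ t in (0 : ℝ)..(π / 2), √(1 - x * Real.sin t ^ 2) := by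
  unfold E
  exact intervalIntegral.integral_congr fun t _ => (Real.sqrt_eq_rpow _).symm

lemma cont_sq (x : ℝ) : Continuous fun t : ℝ => √(1 - x * Real.sin t ^ 2) := by fun_prop

lemma cont_isq {x : ℝ} (hx : x < 1) : Continuous fun t : ℝ => 1 / √(1 - x * Real.sin t ^ 2) :=
  continuous_const.div (cont_sq x) fun t => (Real.sqrt_pos.2 (delta_pos hx t)).ne'

lemma cont_isq3 {x : ℝ} (hx : x < 1) :
    Continuous fun t : ℝ => 1 / (√(1 - x * Real.sin t ^ 2) * (1 - x * Real.sin t ^ 2)) :=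
  continuous_const.div (by fun_prop) fun t =>
    (mul_pos (Real.sqrt_pos.2 (delta_pos hx t)) (delta_pos hx t)).ne'

lemma E_deriv {x : ℝ} (h0 : 0 < x) (hx : x < 1) : HasDerivAt E ((E x - K x) / (2 * x)) x := by
  have h : HasDerivAt E _ x := hasDerivAt_I (1/2) x hx
  refine h.congr_deriv ?_
  symm
  rw [K_eq hx, E_eq, ← intervalIntegral.integral_sub ((cont_sq x).intervalIntegrable _ _)
    ((cont_isq hx).intervalIntegrable _ _), div_eq_inv_mul, ← intervalIntegral.integral_const_mul]
  refine intervalIntegral.integral_congr fun t _ => ?_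
  have hd := delta_pos hx t
  have hs := Real.sqrt_pos.2 hd
  have hq := Real.sq_sqrt hd.le
  have e : ((1:ℝ)/2 - 1) = -(1/2) := by norm_num
  simp only [e, rpow_mh hd]
  field_simp
  rw [hq]; ring

lemma J_eq {x : ℝ} (hx : x < 1) :
    (1 - x) * ∫ t in (0 : ℝ)..(π / 2), 1 / (√(1 - x * Real.sin t ^ 2) * (1 - x * Real.sin t ^ 2))
      = E x := by
  have key : ∫ t in (0 : ℝ)..(π / 2), (√(1 - x * Real.sin t ^ 2) - (1 - x) *
      (1 / (√(1 - x * Real.sin t ^ 2) * (1 - x * Real.sin t ^ 2)))) = 0 := by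
    have hd : ∀ t ∈ uIcc 0 (π / 2), HasDerivAt
        (fun t => x * (Real.sin t * Real.cos t) / √(1 - x * Real.sin t ^ 2))
        (√(1 - x * Real.sin t ^ 2) - (1 - x) *
          (1 / (√(1 - x * Real.sin t ^ 2) * (1 - x * Real.sin t ^ 2)))) t := by
      intro t _
      have hp := delta_pos hx t
      have hs := Real.sqrt_pos.2 hp
      have hq := Real.sq_sqrt hp.le
      have h1 : HasDerivAt (fun t => 1 - x * Real.sin t ^ 2)
          (-(x * (2 * Real.sin t * Real.cos t))) t := by
        simpa using (((Real.hasDerivAt_sin t).pow 2).const_mul x).const_sub 1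
      have h2 := h1.sqrt hp.ne'
      have h3 := ((Real.hasDerivAt_sin t).mul (Real.hasDerivAt_cos t)).const_mul x
      have h4 := h3.div h2 hs.ne'
      refine h4.congr_deriv ?_
      symm
      have hc : Real.cos t ^ 2 = 1 - Real.sin t ^ 2 := by
        have := Real.sin_sq_add_cos_sq t; linarith
      simp only [Pi.mul_apply]
      set w := √(1 - x * Real.sin t ^ 2) with hw
      rw [← hq]
      have hwe : x * Real.sin t ^ 2 = 1 - w ^ 2 := by linarith
      field_simp
      generalize Real.sin t = S at *
      generalize Real.cos t = c at *
      have e4 : w ^ 4 = (1 - x * S ^ 2) ^ 2 := by rw [← hq]; ring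
      ring_nf
      simp only [e4, hq, hc]
      ring
    rw [intervalIntegral.integral_eq_sub_of_hasDerivAt hd]
    · simp
    · exact ((cont_sq x).sub (continuous_const.mul (cont_isq3 hx))).intervalIntegrable _ _
  rw [intervalIntegral.integral_sub ((cont_sq x).intervalIntegrable _ _)
    ((by exact continuous_const.mul (cont_isq3 hx) : Continuous fun t : ℝ => (1 - x) *
      (1 / (√(1 - x * Real.sin t ^ 2) * (1 - x * Real.sin t ^ 2)))).intervalIntegrable _ _),
    intervalIntegral.integral_const_mul, ← E_eq] at key
  linarith

lemma K_deriv {x : ℝ} (h0 : 0 < x) (hx : x < 1) :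
    HasDerivAt K ((E x - (1 - x) * K x) / (2 * x * (1 - x))) x := by
  have h : HasDerivAt K _ x := hasDerivAt_I (-(1/2)) x hx
  refine h.congr_deriv ?_
  symm
  have hy : 0 < 1 - x := by linarith
  have e : (E x - (1 - x) * K x) / (2 * x * (1 - x)) = (2 * x)⁻¹ *
      ((∫ t in (0 : ℝ)..(π / 2), 1 / (√(1 - x * Real.sin t ^ 2) * (1 - x * Real.sin t ^ 2)))
        - K x) := by
    rw [← J_eq hx]; field_simp
  rw [e, K_eq hx, ← intervalIntegral.integral_sub ((cont_isq3 hx).intervalIntegrable _ _)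
    ((cont_isq hx).intervalIntegrable _ _), ← intervalIntegral.integral_const_mul]
  refine intervalIntegral.integral_congr fun t _ => ?_
  have hd := delta_pos hx t
  have hs := Real.sqrt_pos.2 hd
  simp only [rpow_m3h hd]
  field_simp
  ring

lemma K_zero : K 0 = π / 2 := by simp [K]
lemma E_zero : E 0 = π / 2 := by simp [E]

lemma K_cont {x : ℝ} (hx : x < 1) : ContinuousAt K x := (hasDerivAt_I (-(1/2)) x hx).continuousAt
lemma E_cont {x : ℝ} (hx : x < 1) : ContinuousAt E x := (hasDerivAt_I (1/2) x hx).continuousAt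

lemma K_pos {x : ℝ} (hx : x < 1) : 0 < K x := by
  rw [K_eq hx]
  refine intervalIntegral.intervalIntegral_pos_of_pos ((cont_isq hx).intervalIntegrable _ _) ?_
    (by positivity)
  intro t
  exact one_div_pos.2 (Real.sqrt_pos.2 (delta_pos hx t))

lemma EK_eq {x : ℝ} (hx : x < 1) : E x - (1 - x) * K x =
    ∫ t in (0 : ℝ)..(π / 2), x * (Real.cos t ^ 2 / √(1 - x * Real.sin t ^ 2)) := by
  rw [E_eq, K_eq hx, ← intervalIntegral.integral_const_mul, ← intervalIntegral.integral_sub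
    ((cont_sq x).intervalIntegrable _ _)
    ((by exact continuous_const.mul (cont_isq hx) : Continuous fun t : ℝ => (1 - x) *
      (1 / √(1 - x * Real.sin t ^ 2))).intervalIntegrable _ _)]
  refine intervalIntegral.integral_congr fun t _ => ?_
  have hd := delta_pos hx t
  have hs := Real.sqrt_pos.2 hd
  have hq := Real.sq_sqrt hd.le
  have hc : Real.cos t ^ 2 = 1 - Real.sin t ^ 2 := by
    have := Real.sin_sq_add_cos_sq t; linarith
  field_simp
  rw [hq, hc]; ring

lemma cos_le_sqrt {x : ℝ} (hx : x < 1) (t : ℝ) : Real.cos t ≤ √(1 - x * Real.sin t ^ 2) := by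
  apply Real.le_sqrt_of_sq_le
  have := Real.sin_sq_add_cos_sq t
  nlinarith [sq_nonneg (Real.sin t)]

lemma cos_nn {t : ℝ} (ht : t ∈ Icc 0 (π / 2)) : 0 ≤ Real.cos t :=
  Real.cos_nonneg_of_mem_Icc ⟨by linarith [ht.1, Real.pi_pos], ht.2⟩

lemma cont_c {x : ℝ} (hx : x < 1) :
    Continuous fun t : ℝ => x * (Real.cos t ^ 2 / √(1 - x * Real.sin t ^ 2)) :=
  continuous_const.mul ((by fun_prop : Continuous fun t : ℝ => Real.cos t ^ 2).div (cont_sq x)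
    fun t => (Real.sqrt_pos.2 (delta_pos hx t)).ne')

lemma EK_nonneg {x : ℝ} (h0 : 0 ≤ x) (hx : x < 1) : 0 ≤ E x - (1 - x) * K x := by
  rw [EK_eq hx]
  exact intervalIntegral.integral_nonneg (by positivity) fun t _ => by positivity

lemma EK_le {x : ℝ} (h0 : 0 ≤ x) (hx : x < 1) : E x - (1 - x) * K x ≤ x := by
  rw [EK_eq hx]
  have : ∫ t in (0:ℝ)..(π/2), x * Real.cos t = x := by simp
  conv_rhs => rw [← this]
  refine intervalIntegral.integral_mono_on (by positivity) ((cont_c hx).intervalIntegrable _ _)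
    ((by fun_prop : Continuous fun t : ℝ => x * Real.cos t).intervalIntegrable _ _) ?_
  intro t ht
  refine mul_le_mul_of_nonneg_left ?_ h0
  rw [div_le_iff₀ (Real.sqrt_pos.2 (delta_pos hx t)), sq]
  exact mul_le_mul_of_nonneg_left (cos_le_sqrt hx t) (cos_nn ht)

lemma one_le_E {x : ℝ} (hx : x < 1) : 1 ≤ E x := by
  rw [E_eq]
  have : ∫ t in (0:ℝ)..(π/2), Real.cos t = 1 := by simp
  conv_lhs => rw [← this]
  exact intervalIntegral.integral_mono_on (by positivity)
    (Real.continuous_cos.intervalIntegrable _ _) ((cont_sq x).intervalIntegrable _ _)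
    fun t _ => cos_le_sqrt hx t

/-- monotone tool: derivative sign gives sign of function vanishing at zero -/
lemma neg_of_deriv {f f' : ℝ → ℝ} {b : ℝ} (h0 : f 0 = 0)
    (hc : ∀ x, 0 ≤ x → x < b → ContinuousAt f x)
    (hd : ∀ x, 0 < x → x < b → HasDerivAt f (f' x) x) (hn : ∀ x, 0 < x → x < b → f' x < 0)
    {x : ℝ} (hx0 : 0 < x) (hxb : x < b) : f x < 0 := by
  have : StrictAntiOn f (Ico 0 b) := by
    refine strictAntiOn_of_deriv_neg (convex_Ico 0 b)
      (fun y hy => (hc y hy.1 hy.2).continuousWithinAt) ?_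
    intro y hy
    rw [interior_Ico] at hy
    rw [(hd y hy.1 hy.2).deriv]
    exact hn y hy.1 hy.2
  have h := this (left_mem_Ico.2 (hx0.trans hxb)) ⟨hx0.le, hxb⟩ hx0
  rwa [h0] at h

lemma EK_pos {x : ℝ} (h0 : 0 < x) (hx : x < 1) : 0 < E x - (1 - x) * K x := by
  have h := neg_of_deriv (f := fun x => -(E x - (1 - x) * K x)) (b := 1)
    (f' := fun x => -(K x / 2)) (by simp [K_zero, E_zero])
    (fun x _ h => ((E_cont h).sub ((by fun_prop : ContinuousAt (fun x : ℝ => 1 - x) x).mul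
      (K_cont h))).neg) ?_ (fun x _ h => by have := K_pos h; linarith) h0 hx
  · linarith
  · intro x h0 h
    have hy : 0 < 1 - x := by linarith
    have := ((E_deriv h0 h).sub (((hasDerivAt_id x).const_sub 1).mul (K_deriv h0 h))).neg
    refine this.congr_deriv ?_
    symm
    simp only [id]
    field_simp
    ring

lemma W_pos {x : ℝ} (h0 : 0 < x) (hx : x < 1) : x * K x < 2 * (K x - E x) := by
  have h := neg_of_deriv (f := fun x => x * K x - 2 * (K x - E x)) (b := 1)
    (f' := fun x => -((E x - (1 - x) * K x) / (2 * (1 - x)))) (by simp [K_zero, E_zero])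
    (fun x _ h => (continuousAt_id.mul (K_cont h)).sub (((K_cont h).sub (E_cont h)).const_mul 2))
    ?_ ?_ h0 hx
  · linarith
  · intro x h0 h
    have hy : 0 < 1 - x := by linarith
    have := ((hasDerivAt_id x).mul (K_deriv h0 h)).sub
      (((K_deriv h0 h).sub (E_deriv h0 h)).const_mul 2)
    refine this.congr_deriv ?_
    symm
    simp only [id]
    field_simp
    ring
  · intro x h0 h
    have hy : 0 < 1 - x := by linarith
    have := div_pos (EK_pos h0 h) (by linarith : 0 < 2 * (1 - x))
    linarith

/-- the derivative form -/
noncomputable def GG (x : ℝ) : ℝ :=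
  -12 * (K x - E x) ^ 2 + (8 + x) * (K x - E x) * K x - 2 * x * (2 - x) * K x ^ 2

noncomputable def FF (x : ℝ) : ℝ :=
  2 * (2 - 3 * x) * (K x - E x) ^ 2 + 4 * x * (K x - E x) * K x - x ^ 2 * (3 - x) * K x ^ 2

lemma GG_neg_small {x : ℝ} (h0 : 0 < x) (hx : x < 3 / 4) : GG x < 0 := by
  refine neg_of_deriv (f := GG) (b := 3 / 4)
    (f' := fun x => ((23 * x - 8) * (K x - E x) ^ 2 - (14 * x + 6 * x ^ 2) * (K x - E x) * K x
      + (9 * x ^ 2 - 4 * x ^ 3) * K x ^ 2) / (2 * x * (1 - x))) (by simp [GG, K_zero, E_zero])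
    ?_ ?_ ?_ h0 hx
  · intro x _ h
    have hK := K_cont (show x < 1 by linarith)
    have hE := E_cont (show x < 1 by linarith)
    unfold GG
    fun_prop
  · intro x h0 h
    have h1 : x < 1 := by linarith
    have hy : 0 < 1 - x := by linarith
    have hK := K_deriv h0 h1
    have hE := E_deriv h0 h1
    have hi := hasDerivAt_id x
    have := ((((hK.sub hE).pow 2).const_mul (-12)).add (((hi.const_add 8).mul (hK.sub hE)).mul hK)).sub
      (((hi.const_mul 2).mul (hi.const_sub 2)).mul (hK.pow 2))
    refine this.congr_deriv ?_
    symm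
    simp only [id, Pi.sub_apply, Pi.mul_apply, Pi.pow_apply]
    field_simp
    ring
  · intro x h0 h
    have h1 : x < 1 := by linarith
    have hy : 0 < 1 - x := by linarith
    have hB := K_pos h1
    have hW := W_pos h0 h1
    have hU := EK_pos h0 h1
    refine div_neg_of_neg_of_pos ?_ (by positivity)
    obtain ⟨u, hu⟩ : ∃ u, K x - E x = u * (x * K x) :=
      ⟨(K x - E x) / (x * K x), by field_simp⟩
    have hxB : 0 < x * K x := mul_pos h0 hB
    have hu1 : 1 / 2 < u := by
      by_contra hh
      push Not at hh
      nlinarith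
    have hu2 : u < 1 := by
      by_contra hh
      push Not at hh
      nlinarith
    have e : (23 * x - 8) * (K x - E x) ^ 2 - (14 * x + 6 * x ^ 2) * (K x - E x) * K x
      + (9 * x ^ 2 - 4 * x ^ 3) * K x ^ 2
      = (x * K x) ^ 2 * ((23 * x - 8) * u ^ 2 - (14 + 6 * x) * u + (9 - 4 * x)) := by
      rw [hu]; ring
    rw [e]
    refine mul_neg_of_pos_of_neg (by positivity) ?_
    have : (23 * x - 8) * u ^ 2 - (14 + 6 * x) * u + (9 - 4 * x)
      = -(5/4) * x + (u - 1/2) * ((23 * x - 8) * (u + 1/2) - (14 + 6 * x)) := by ring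
    rw [this]
    have h3 : (23 * x - 8) * (u + 1/2) - (14 + 6 * x) < 0 := by nlinarith
    nlinarith [mul_pos (sub_pos.2 hu1) (neg_pos.2 h3)]

lemma GG_neg {x : ℝ} (h0 : 0 < x) (hx : x < 1) : GG x < 0 := by
  rcases lt_or_ge x (3 / 4) with h | h
  · exact GG_neg_small h0 h
  · have hB := K_pos hx
    unfold GG
    have e : -12 * (K x - E x) ^ 2 + (8 + x) * (K x - E x) * K x - 2 * x * (2 - x) * K x ^ 2
      = -12 * ((K x - E x) - (8 + x) / 24 * K x) ^ 2
        + (64 - 176 * x + 97 * x ^ 2) / 48 * K x ^ 2 := by ring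
    rw [e]
    have : (64 - 176 * x + 97 * x ^ 2) < 0 := by nlinarith
    nlinarith [sq_nonneg ((K x - E x) - (8 + x) / 24 * K x), mul_pos (neg_pos.2 this) (pow_pos hB 2)]

lemma FF_neg {x : ℝ} (h0 : 0 < x) (hx : x < 1) : FF x < 0 := by
  refine neg_of_deriv (f := FF) (b := 1) (f' := GG) (by simp [FF, K_zero, E_zero])
    ?_ ?_ (fun x h0 h => GG_neg h0 h) h0 hx
  · intro x _ h
    have hK := K_cont h
    have hE := E_cont h
    unfold FF
    fun_prop
  · intro x h0 h1
    have hy : 0 < 1 - x := by linarith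
    have hK := K_deriv h0 h1
    have hE := E_deriv h0 h1
    have hi := hasDerivAt_id x
    have := (((((hi.const_mul 3).const_sub 2).const_mul 2).mul ((hK.sub hE).pow 2)).add
      (((hi.const_mul 4).mul (hK.sub hE)).mul hK)).sub
      (((hi.pow 2).mul (hi.const_sub 3)).mul (hK.pow 2))
    refine this.congr_deriv ?_
    symm
    simp only [id, Pi.sub_apply, Pi.mul_apply, Pi.pow_apply, GG]
    field_simp
    ring

lemma DD_neg {x : ℝ} (h0 : 0 < x) (hx : x < 1) :
    2 * E x ^ 2 - 2 * E x * K x + x * (1 - x) * K x ^ 2 < 0 := by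
  have hB := K_pos hx
  have hW := W_pos h0 hx
  have hU := EK_pos h0 hx
  have hE := one_le_E hx
  -- E between (1-x) K and (1 - x/2) K
  have h1 : 0 < ((1 - x / 2) * K x - E x) * (E x - (1 - x) * K x) := mul_pos (by linarith) hU
  nlinarith [mul_pos (mul_pos h0 hB) hU, mul_pos (mul_pos h0 hB) hB]

lemma phi_deriv {x : ℝ} (h0 : 0 < x) (hx : x < 1) : HasDerivAt φ
    (FF x * K x ^ 2 / (2 * (2 * E x ^ 2 - 2 * E x * K x + x * (1 - x) * K x ^ 2) ^ 2)) x := by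
  have hy : 0 < 1 - x := by linarith
  have hD := (DD_neg h0 hx).ne
  have hK := K_deriv h0 hx
  have hE := E_deriv h0 hx
  have hi := hasDerivAt_id x
  have := (((hi.const_sub 1).log hy.ne').const_mul (1/2)).add
    ((((hi.const_mul 2).mul hK).mul (hE.sub hK)).div
      ((((hE.pow 2).const_mul 2).sub ((hE.const_mul 2).mul hK)).add
        ((hi.mul (hi.const_sub 1)).mul (hK.pow 2))) hD)
  refine this.congr_deriv ?_
  symm
  simp only [id, Pi.sub_apply, Pi.mul_apply, Pi.pow_apply, Pi.add_apply, FF]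
  generalize hd : 2 * E x ^ 2 - 2 * E x * K x + x * (1 - x) * K x ^ 2 = d at *
  field_simp
  rw [← hd]
  ring

lemma phi_anti : StrictAntiOn φ (Ioo 0 1) := by
  refine strictAntiOn_of_deriv_neg (convex_Ioo 0 1)
    (fun y hy => (phi_deriv hy.1 hy.2).continuousAt.continuousWithinAt) ?_
  intro y hy
  rw [interior_Ioo] at hy
  rw [(phi_deriv hy.1 hy.2).deriv]
  have h1 := FF_neg hy.1 hy.2
  have h2 := K_pos hy.2
  have h3 := (DD_neg hy.1 hy.2).ne
  refine div_neg_of_neg_of_pos (mul_neg_of_neg_of_pos h1 (by positivity)) (by positivity)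

lemma gt_mem : ∀ᶠ x : ℝ in nhdsWithin 0 (Ioi 0), 0 < x ∧ x < 1 := by
  rw [← nhdsWithin_Ioo_eq_nhdsGT (zero_lt_one' ℝ)]
  exact self_mem_nhdsWithin

lemma lt_mem : ∀ᶠ x : ℝ in nhdsWithin 1 (Iio 1), 0 < x ∧ x < 1 := by
  rw [← nhdsWithin_Ioo_eq_nhdsLT (zero_lt_one' ℝ)]
  exact self_mem_nhdsWithin

lemma K_tend0 : Tendsto K (nhdsWithin 0 (Ioi 0)) (nhds (π / 2)) := by
  have := (K_cont (zero_lt_one' ℝ)).tendsto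
  rw [K_zero] at this
  exact this.mono_left nhdsWithin_le_nhds

lemma E_tend0 : Tendsto E (nhdsWithin 0 (Ioi 0)) (nhds (π / 2)) := by
  have := (E_cont (zero_lt_one' ℝ)).tendsto
  rw [E_zero] at this
  exact this.mono_left nhdsWithin_le_nhds

lemma id_tend0 : Tendsto (fun x : ℝ => x) (nhdsWithin 0 (Ioi 0)) (nhds 0) :=
  tendsto_id.mono_left nhdsWithin_le_nhds

lemma A_tend0 : Tendsto (fun x => (K x - E x) / x) (nhdsWithin 0 (Ioi 0)) (nhds (π / 4)) := by
  refine HasDerivAt.lhopital_zero_nhdsGT (f' := fun x => E x / (2 * (1 - x))) (g' := fun _ => 1)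
    ?_ ?_ ?_ ?_ ?_ ?_
  · filter_upwards [gt_mem] with x hx
    have hy : 0 < 1 - x := by linarith [hx.2]
    have h0 := hx.1
    refine ((K_deriv hx.1 hx.2).sub (E_deriv hx.1 hx.2)).congr_deriv ?_
    field_simp
    ring
  · exact Filter.Eventually.of_forall fun x => hasDerivAt_id x
  · exact Filter.Eventually.of_forall fun x => one_ne_zero
  · simpa using K_tend0.sub E_tend0
  · exact id_tend0
  · have h := E_tend0.div ((id_tend0.const_sub 1).const_mul 2) (by norm_num)
    have e : π / 2 / (2 * (1 - 0)) = π / 4 := by ring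
    rw [e] at h
    refine h.congr fun x => ?_
    simp

lemma W_tend0 : Tendsto (fun x => (2 * (K x - E x) - x * K x) / x ^ 2) (nhdsWithin 0 (Ioi 0))
    (nhds (π / 16)) := by
  refine HasDerivAt.lhopital_zero_nhdsGT
    (f' := fun x => (E x - (1 - x) * K x) / (2 * (1 - x))) (g' := fun x => 2 * x)
    ?_ ?_ ?_ ?_ ?_ ?_
  · filter_upwards [gt_mem] with x hx
    have hy : 0 < 1 - x := by linarith [hx.2]
    have h0 := hx.1
    refine ((((K_deriv hx.1 hx.2).sub (E_deriv hx.1 hx.2)).const_mul 2).sub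
      ((hasDerivAt_id x).mul (K_deriv hx.1 hx.2))).congr_deriv ?_
    simp only [id]
    field_simp
    ring
  · exact Filter.Eventually.of_forall fun x => by simpa using hasDerivAt_pow 2 x
  · filter_upwards [gt_mem] with x hx
    have := hx.1
    positivity
  · simpa using ((K_tend0.sub E_tend0).const_mul 2).sub (id_tend0.mul K_tend0)
  · simpa using id_tend0.pow 2
  · have h := (K_tend0.sub A_tend0).div ((id_tend0.const_sub 1).const_mul 4) (by norm_num)
    have e : (π / 2 - π / 4) / (4 * (1 - 0)) = π / 16 := by ring
    rw [e] at h
    refine h.congr' ?_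
    filter_upwards [gt_mem] with x hx
    have hy : 0 < 1 - x := by linarith [hx.2]
    have h0 := hx.1
    simp only [Pi.div_apply]
    field_simp
    ring

lemma phi_lim0 : Tendsto φ (nhdsWithin 0 (Ioo 0 1)) (nhds (8/5)) := by
  rw [nhdsWithin_Ioo_eq_nhdsGT (zero_lt_one' ℝ)]
  have hpi := Real.pi_pos
  have hl : Tendsto (fun x : ℝ => (1/2) * Real.log (1 - x)) (nhdsWithin 0 (Ioi 0)) (nhds 0) := by
    have := ((id_tend0.const_sub 1).log (by norm_num)).const_mul (1/2)
    simpa using this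
  have hden : Tendsto (fun x => E x * ((2 * (K x - E x) - x * K x) / x ^ 2)
      + K x * (K x - (K x - E x) / x)) (nhdsWithin 0 (Ioi 0))
      (nhds (π / 2 * (π / 16) + π / 2 * (π / 2 - π / 4))) :=
    (E_tend0.mul W_tend0).add (K_tend0.mul (K_tend0.sub A_tend0))
  have hne : π / 2 * (π / 16) + π / 2 * (π / 2 - π / 4) ≠ 0 := by
    have : 0 < π ^ 2 := by positivity
    nlinarith
  have h := hl.add (((K_tend0.const_mul 2).mul A_tend0).div hden hne)
  have e : 0 + 2 * (π / 2) * (π / 4) / (π / 2 * (π / 16) + π / 2 * (π / 2 - π / 4)) = 8 / 5 := by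
    field_simp
    norm_num
  rw [e] at h
  refine h.congr' ?_
  filter_upwards [gt_mem] with x hx
  have h0 := hx.1
  have hD := (DD_neg hx.1 hx.2).ne
  have e2 : E x * ((2 * (K x - E x) - x * K x) / x ^ 2) + K x * (K x - (K x - E x) / x)
    = -(2 * E x ^ 2 - 2 * E x * K x + x * (1 - x) * K x ^ 2) / x ^ 2 := by
    field_simp
    ring
  simp only [φ, Pi.div_apply]
  rw [e2]
  generalize 2 * E x ^ 2 - 2 * E x * K x + x * (1 - x) * K x ^ 2 = d at *
  field_simp
  ring

lemma int_sin {x : ℝ} (h0 : 0 < x) (hx : x < 1) :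
    ∫ t in (0 : ℝ)..(π / 2), Real.sin t / √(1 - x * Real.sin t ^ 2)
      = (Real.log (1 + √x) - (1/2) * Real.log (1 - x)) / √x := by
  have hx' := Real.sqrt_pos.2 h0
  have hxx := Real.sq_sqrt h0.le
  have hd : ∀ t ∈ uIcc 0 (π / 2), HasDerivAt
      (fun t => -(Real.log (√x * Real.cos t + √(1 - x * Real.sin t ^ 2)) / √x))
      (Real.sin t / √(1 - x * Real.sin t ^ 2)) t := by
    intro t ht
    rw [uIcc_of_le (by positivity)] at ht
    have hp := delta_pos hx t
    have hs := Real.sqrt_pos.2 hp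
    have hc := cos_nn ht
    have hpos : 0 < √x * Real.cos t + √(1 - x * Real.sin t ^ 2) := by positivity
    have h1 : HasDerivAt (fun t => 1 - x * Real.sin t ^ 2)
        (-(x * (2 * Real.sin t * Real.cos t))) t := by
      simpa using (((Real.hasDerivAt_sin t).pow 2).const_mul x).const_sub 1
    have h2 := h1.sqrt hp.ne'
    have h3 := (((((Real.hasDerivAt_cos t).const_mul (√x)).add h2).log hpos.ne').div_const (√x)).neg
    refine h3.congr_deriv ?_
    simp only [Pi.add_apply]
    generalize √(1 - x * Real.sin t ^ 2) = w at *
    have hn := hpos.ne'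
    rw [← hxx]
    simp only [hxx]
    field_simp
    rw [← hxx]
    simp only [Real.sqrt_sq hx'.le]
    ring
  rw [intervalIntegral.integral_eq_sub_of_hasDerivAt hd]
  · have : √(1 - x) ≠ 0 := (Real.sqrt_pos.2 (by linarith)).ne'
    simp [Real.log_sqrt (by linarith : 0 ≤ 1 - x)]
    ring_nf
  · exact (Real.continuous_sin.div (cont_sq x)
      fun t => (Real.sqrt_pos.2 (delta_pos hx t)).ne').intervalIntegrable _ _

lemma cos_pos_ae {t : ℝ} (ht : t ∈ Ioo 0 (π / 2)) : 0 < Real.cos t :=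
  Real.cos_pos_of_mem_Ioo ⟨by linarith [ht.1, Real.pi_pos], ht.2⟩

lemma ae_Ioo : ∀ᵐ t : ℝ, t ∈ uIoc 0 (π / 2) → t ∈ Ioo 0 (π / 2) := by
  have : ∀ᵐ t : ℝ, t ≠ π / 2 := by
    simp [MeasureTheory.ae_iff]
  filter_upwards [this] with t ht h
  rw [uIoc_of_le (by positivity)] at h
  exact ⟨h.1, lt_of_le_of_ne h.2 ht⟩

lemma int_lim : ∫ t in (0 : ℝ)..(π / 2), (1 - Real.sin t) / Real.cos t = Real.log 2 := by
  have e : ∫ t in (0 : ℝ)..(π / 2), (1 - Real.sin t) / Real.cos t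
      = ∫ t in (0 : ℝ)..(π / 2), Real.cos t / (1 + Real.sin t) := by
    refine intervalIntegral.integral_congr_ae ?_
    filter_upwards [ae_Ioo] with t h ht
    have hc := cos_pos_ae (h ht)
    have hs : 0 ≤ Real.sin t := Real.sin_nonneg_of_nonneg_of_le_pi (h ht).1.le
      (by linarith [(h ht).2, Real.pi_pos])
    have := Real.sin_sq_add_cos_sq t
    rw [div_eq_div_iff hc.ne' (by positivity)]
    linarith
  have hpos : ∀ t ∈ uIcc 0 (π / 2), 0 < 1 + Real.sin t := by
    intro t ht
    rw [uIcc_of_le (by positivity)] at ht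
    have hs : 0 ≤ Real.sin t := Real.sin_nonneg_of_nonneg_of_le_pi ht.1
      (by linarith [ht.2, Real.pi_pos])
    linarith
  rw [e, intervalIntegral.integral_eq_sub_of_hasDerivAt
    (f := fun t => Real.log (1 + Real.sin t))]
  · norm_num
  · intro t ht
    exact ((Real.hasDerivAt_sin t).const_add 1).log (hpos t ht).ne'
  · refine ContinuousOn.intervalIntegrable (ContinuousOn.div (by fun_prop) (by fun_prop) ?_)
    intro t ht
    exact (hpos t ht).ne'

lemma id_tend1 : Tendsto (fun x : ℝ => x) (nhdsWithin 1 (Iio 1)) (nhds 1) :=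
  tendsto_id.mono_left nhdsWithin_le_nhds

lemma dct_lim : Tendsto (fun x : ℝ => ∫ t in (0 : ℝ)..(π / 2),
    (1 - Real.sin t) / √(1 - x * Real.sin t ^ 2)) (nhdsWithin 1 (Iio 1)) (nhds (Real.log 2)) := by
  rw [← int_lim]
  refine intervalIntegral.tendsto_integral_filter_of_dominated_convergence (fun _ => 1) ?_ ?_ ?_ ?_
  · filter_upwards [lt_mem] with x hx
    exact ((by fun_prop : Continuous fun t : ℝ => 1 - Real.sin t).div (cont_sq x)
      fun t => (Real.sqrt_pos.2 (delta_pos hx.2 t)).ne').aestronglyMeasurable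
  · filter_upwards [lt_mem] with x hx
    refine Filter.Eventually.of_forall fun t ht => ?_
    rw [uIoc_of_le (by positivity)] at ht
    have hs := Real.sqrt_pos.2 (delta_pos hx.2 t)
    have h1 := Real.sin_le_one t
    have h2 := cos_le_sqrt hx.2 t
    have h3 := cos_nn ⟨ht.1.le, ht.2⟩
    have h4 : 0 ≤ Real.sin t := Real.sin_nonneg_of_nonneg_of_le_pi ht.1.le
      (by linarith [ht.2, Real.pi_pos])
    have h5 := Real.sin_sq_add_cos_sq t
    rw [Real.norm_of_nonneg (div_nonneg (by linarith) hs.le), div_le_one hs]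
    have : 1 - Real.sin t ≤ Real.cos t := by nlinarith
    linarith
  · exact intervalIntegrable_const
  · filter_upwards [ae_Ioo] with t h ht
    have hc := cos_pos_ae (h ht)
    have : √(1 - 1 * Real.sin t ^ 2) = Real.cos t := by
      rw [one_mul, ← Real.cos_sq', Real.sqrt_sq hc.le]
    have h1 : Tendsto (fun x : ℝ => √(1 - x * Real.sin t ^ 2)) (nhdsWithin 1 (Iio 1))
        (nhds (Real.cos t)) := by
      rw [← this]
      exact ((id_tend1.mul_const _).const_sub 1).sqrt
    exact tendsto_const_nhds.div h1 hc.ne'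

lemma y_tend : Tendsto (fun x : ℝ => 1 - x) (nhdsWithin 1 (Iio 1)) (nhdsWithin 0 (Ioi 0)) := by
  refine tendsto_nhdsWithin_iff.2 ⟨by simpa using id_tend1.const_sub 1, ?_⟩
  filter_upwards [lt_mem] with x hx
  exact sub_pos.2 hx.2

lemma ylog : Tendsto (fun x : ℝ => Real.log (1 - x) * (1 - x)) (nhdsWithin 1 (Iio 1)) (nhds 0) := by
  have := tendsto_log_mul_rpow_nhdsGT_zero (r := 1) one_pos
  refine (this.comp y_tend).congr fun x => ?_
  simp

lemma ylog2 : Tendsto (fun x : ℝ => Real.log (1 - x) ^ 2 * (1 - x)) (nhdsWithin 1 (Iio 1))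
    (nhds 0) := by
  have := ((tendsto_log_mul_rpow_nhdsGT_zero (r := 1/2) (by norm_num)).comp y_tend).pow 2
  simp only [ne_eq, OfNat.ofNat_ne_zero, not_false_eq_true, zero_pow] at this
  refine this.congr' ?_
  filter_upwards [lt_mem] with x hx
  simp only [Function.comp]
  rw [mul_pow, ← Real.sqrt_eq_rpow, Real.sq_sqrt (by linarith [hx.2])]

lemma K_asymp : Tendsto (fun x => K x + (1/2) * Real.log (1 - x)) (nhdsWithin 1 (Iio 1))
    (nhds (Real.log 4)) := by
  have hs : Tendsto (fun x : ℝ => √x) (nhdsWithin 1 (Iio 1)) (nhds 1) := by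
    simpa using id_tend1.sqrt
  have h1 : Tendsto (fun x : ℝ => Real.log (1 + √x) / √x) (nhdsWithin 1 (Iio 1))
      (nhds (Real.log 2)) := by
    have := ((hs.const_add 1).log (by norm_num)).div hs one_ne_zero
    norm_num at this
    exact this
  have h2 : Tendsto (fun x : ℝ => (1/2) * (Real.log (1 - x) * (1 - x)) / (√x * (1 + √x)))
      (nhdsWithin 1 (Iio 1)) (nhds 0) := by
    have := (ylog.const_mul (1/2)).div (hs.mul (hs.const_add 1)) (by norm_num)
    rw [mul_zero, zero_div] at this
    exact this
  have h := (dct_lim.add h1).sub h2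
  have e : Real.log 2 + Real.log 2 - 0 = Real.log 4 := by
    rw [show (4:ℝ) = 2 * 2 by norm_num, Real.log_mul two_ne_zero two_ne_zero, sub_zero]
  rw [e] at h
  refine h.congr' ?_
  filter_upwards [lt_mem] with x hx
  have hx0 := Real.sqrt_pos.2 hx.1
  have hxx := Real.sq_sqrt hx.1.le
  have hK : K x = (∫ t in (0 : ℝ)..(π / 2), (1 - Real.sin t) / √(1 - x * Real.sin t ^ 2))
      + ∫ t in (0 : ℝ)..(π / 2), Real.sin t / √(1 - x * Real.sin t ^ 2) := by
    rw [K_eq hx.2, ← intervalIntegral.integral_add]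
    · refine intervalIntegral.integral_congr fun t _ => ?_
      ring
    · exact ((by fun_prop : Continuous fun t : ℝ => 1 - Real.sin t).div (cont_sq x)
        fun t => (Real.sqrt_pos.2 (delta_pos hx.2 t)).ne').intervalIntegrable _ _
    · exact (Real.continuous_sin.div (cont_sq x)
        fun t => (Real.sqrt_pos.2 (delta_pos hx.2 t)).ne').intervalIntegrable _ _
  rw [hK, int_sin hx.1 hx.2]
  generalize Real.log (1 - x) = l
  generalize (∫ t in (0 : ℝ)..(π / 2), (1 - Real.sin t) / √(1 - x * Real.sin t ^ 2)) = I
  have e2 : 1 - x = (1 - √x) * (1 + √x) := by nlinarith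
  rw [e2]
  field_simp
  ring

lemma yK2 : Tendsto (fun x => (1 - x) * K x ^ 2) (nhdsWithin 1 (Iio 1)) (nhds 0) := by
  have hy : Tendsto (fun x : ℝ => 1 - x) (nhdsWithin 1 (Iio 1)) (nhds 0) :=
    y_tend.mono_right nhdsWithin_le_nhds
  have h := ((hy.mul (K_asymp.pow 2)).sub (ylog.mul K_asymp)).add (ylog2.const_mul (1/4))
  simp only [zero_mul, mul_zero, sub_zero, add_zero] at h
  refine h.congr fun x => ?_
  ring

lemma K_top : Tendsto K (nhdsWithin 1 (Iio 1)) atTop := by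
  have h1 : Tendsto (fun x : ℝ => -((1/2) * Real.log (1 - x))) (nhdsWithin 1 (Iio 1)) atTop := by
    refine tendsto_neg_atBot_atTop.comp ?_
    exact (Real.tendsto_log_nhdsGT_zero.comp y_tend).const_mul_atBot (by norm_num)
  refine (K_asymp.add_atTop h1).congr fun x => ?_
  ring

lemma yK : Tendsto (fun x => (1 - x) * K x) (nhdsWithin 1 (Iio 1)) (nhds 0) := by
  have h := yK2.mul K_top.inv_tendsto_atTop
  rw [zero_mul] at h
  refine h.congr' ?_
  filter_upwards [lt_mem] with x hx
  have := K_pos hx.2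
  simp only [Pi.inv_apply]
  field_simp

lemma Ex : Tendsto (fun x => (E x - x) * K x) (nhdsWithin 1 (Iio 1)) (nhds 0) := by
  refine tendsto_of_tendsto_of_tendsto_of_le_of_le' tendsto_const_nhds yK2 ?_ ?_
  · filter_upwards [lt_mem] with x hx
    have := K_pos hx.2
    have := one_le_E hx.2
    exact mul_nonneg (by linarith [hx.2]) (by linarith)
  · filter_upwards [lt_mem] with x hx
    have := K_pos hx.2
    have := EK_le hx.1.le hx.2
    nlinarith

lemma Ex0 : Tendsto (fun x => E x - x) (nhdsWithin 1 (Iio 1)) (nhds 0) := by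
  have h := Ex.mul K_top.inv_tendsto_atTop
  rw [zero_mul] at h
  refine h.congr' ?_
  filter_upwards [lt_mem] with x hx
  have := K_pos hx.2
  simp only [Pi.inv_apply]
  field_simp

lemma E_tend1 : Tendsto E (nhdsWithin 1 (Iio 1)) (nhds 1) := by
  have h := Ex0.add id_tend1
  simpa using h

lemma phi_lim1 : Tendsto φ (nhdsWithin 1 (Ioo 0 1)) (nhds (Real.log 4)) := by
  rw [nhdsWithin_Ioo_eq_nhdsLT (zero_lt_one' ℝ)]
  have hden : Tendsto (fun x => 2 * E x ^ 2 * (K x)⁻¹ - 2 * E x + x * ((1 - x) * K x))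
      (nhdsWithin 1 (Iio 1)) (nhds (2 * 1 ^ 2 * 0 - 2 * 1 + 1 * 0)) :=
    ((((E_tend1.pow 2).const_mul 2).mul K_top.inv_tendsto_atTop).sub
      (E_tend1.const_mul 2)).add (id_tend1.mul yK)
  have hnum : Tendsto (fun x => 2 * ((E x - x) * K x) - 2 * E x * (E x - x)
      - x * ((1 - x) * K x ^ 2)) (nhdsWithin 1 (Iio 1)) (nhds (2 * 0 - 2 * 1 * 0 - 1 * 0)) :=
    ((Ex.const_mul 2).sub ((E_tend1.const_mul 2).mul Ex0)).sub (id_tend1.mul yK2)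
  have h := K_asymp.add (hnum.div hden (by norm_num))
  norm_num at h
  refine h.congr' ?_
  filter_upwards [lt_mem] with x hx
  have hK := K_pos hx.2
  have hD := (DD_neg hx.1 hx.2).ne
  have e : 2 * E x ^ 2 * (K x)⁻¹ - 2 * E x + x * ((1 - x) * K x)
    = (2 * E x ^ 2 - 2 * E x * K x + x * (1 - x) * K x ^ 2) / K x := by
    field_simp
  rw [φ, e]
  generalize hd : 2 * E x ^ 2 - 2 * E x * K x + x * (1 - x) * K x ^ 2 = d at *
  have e3 : 2 * ((E x - x) * K x) - 2 * E x * (E x - x) - x * ((1 - x) * K x ^ 2)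
      = 2 * x * (E x - K x) - d := by rw [← hd]; ring
  rw [e3]
  field_simp
  ring

theorem stmt7 :
    StrictAntiOn φ (Ioo 0 1) ∧
    Tendsto φ (nhdsWithin 0 (Ioo 0 1)) (nhds (8/5)) ∧
    Tendsto φ (nhdsWithin 1 (Ioo 0 1)) (nhds (Real.log 4)) :=
  ⟨phi_anti, phi_lim0, phi_lim1⟩
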